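/- For every y ∈ K̄ \ S, the shifted measure μ_y defined by μ_y(A) = μ(A − y) is mutually singular with μ, where S = {x ∈ K̄ : ‖T_n(x)‖ ≤ q_n^{d_n/m_n}·‖m_n‖ for all n ≥ 1}. -/

import Mathlib

open MeasureTheory Module
open scoped Classical

noncomputable section

/-- The topology defined by a translation-invariant "norm" function via open balls. -/
def normTopology {X : Type} [Sub X] (f : X → ℝ) : TopologicalSpace X :=
  TopologicalSpace.generateFrom
    {U | ∃ x : X, ∃ ε : ℝ, 0 < ε ∧ U = {y : X | f (y - x) < ε}}

variable (p : ℕ) [Fact (Nat.Prime p)]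
variable (k : Type) [Field k] [Algebra ℚ_[p] k] [FiniteDimensional ℚ_[p] k]

/-- The normalized absolute value on the local field k. -/
def absk (x : k) : ℝ := ‖(Algebra.norm ℚ_[p] x : ℚ_[p])‖

/-- The topology of k as a local field. -/
def kTop : TopologicalSpace k := normTopology (absk p k)

variable (K : Type) [Field K] [Algebra k K] [CharZero K]
variable (Kn : ℕ → IntermediateField k K)

/-- The relative trace map between two intermediate fields. -/
def relTrace (E F : IntermediateField k K) (h : E ≤ F) (x : F) : E :=
  (@Algebra.trace E F _ _ (IntermediateField.inclusion h).toRingHom.toAlgebra) x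

variable (T : ℕ → K →ₗ[k] K)

/-- The projective limit K̄ of the fields Kₙ along the normalized trace maps. -/
def ProjLim : Type :=
  {x : ℕ → K // (∀ n, x n ∈ Kn n) ∧ ∀ ⦃n ν : ℕ⦄, n ≤ ν → T n (x ν) = x n}

/-- Pointwise addition on K̄. -/
def pladd (x y : ProjLim k K Kn T) : ProjLim k K Kn T :=
  ⟨fun n => x.1 n + y.1 n, by
    refine ⟨fun n => add_mem (x.2.1 n) (y.2.1 n), ?_⟩
    intro n ν h
    simp [map_add, x.2.2 h, y.2.2 h]⟩

/-- Pointwise scalar multiplication on K̄. -/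
def plsmul (c : k) (x : ProjLim k K Kn T) : ProjLim k K Kn T :=
  ⟨fun n => c • x.1 n, by
    refine ⟨fun n => (Kn n).toSubalgebra.smul_mem (x.2.1 n) c, ?_⟩
    intro n ν h
    simp [_root_.map_smul, x.2.2 h]⟩

/-- The topology on K̄ given by the seminorms x ↦ ‖xₙ‖. -/
def projTop (Knorm : K → ℝ) : TopologicalSpace (ProjLim k K Kn T) :=
  TopologicalSpace.generateFrom
    {U | ∃ x : ProjLim k K Kn T, ∃ n : ℕ, ∃ ε : ℝ, 0 < ε ∧
          U = {y : ProjLim k K Kn T | Knorm (y.1 n - x.1 n) < ε}}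

/-- The Borel σ-algebra of the seminorm topology on K̄. -/
def projMeas (Knorm : K → ℝ) : MeasurableSpace (ProjLim k K Kn T) :=
  @borel _ (projTop k K Kn T Knorm)

/-- The topology on Kₙ induced from the absolute value ‖·‖. -/
def KnTop (Knorm : K → ℝ) (n : ℕ) : TopologicalSpace (Kn n) :=
  TopologicalSpace.induced Subtype.val (normTopology Knorm)

/-- The Borel σ-algebra of Kₙ. -/
def KnMeas (Knorm : K → ℝ) (n : ℕ) : MeasurableSpace (Kn n) :=
  @borel _ (KnTop k K Kn Knorm n)

/-- The canonical embedding of K into K̄. -/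
def emb (hTmem : ∀ n x, T n x ∈ Kn n)
    (hTproj : ∀ ⦃n ν : ℕ⦄, n ≤ ν → ∀ x : K, T n (T ν x) = T n x) (x : K) :
    ProjLim k K Kn T :=
  ⟨fun n => T n x, fun n => hTmem n x, fun n ν h => hTproj h x⟩

/-- The weak topology σ(K̄, K) on K̄. -/
def weakTop (pairing : K → ProjLim k K Kn T → k) : TopologicalSpace (ProjLim k K Kn T) :=
  ⨅ a : K, TopologicalSpace.induced (pairing a) (kTop p k)

/-- Non-archimedean seminorms on K over k. -/
def IsNASeminorm (f : K → ℝ) : Prop :=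
  (∀ x, 0 ≤ f x) ∧ (∀ x y, f (x + y) ≤ max (f x) (f y)) ∧
    ∀ (c : k) (x : K), f (c • x) = absk p k c * f x

/-- The locally convex topology determined by a family of seminorms. -/
def seminormFamilyTop (F : Set (K → ℝ)) : TopologicalSpace K :=
  TopologicalSpace.generateFrom
    {U | ∃ f ∈ F, ∃ x : K, ∃ ε : ℝ, 0 < ε ∧ U = {y : K | f (y - x) < ε}}

/-- The inductive limit topology on K: the finest locally convex topology over k
making all the inclusions Kₙ → K continuous. -/
def indTop (Knorm : K → ℝ) : TopologicalSpace K :=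
  sInf {t : TopologicalSpace K |
    (∃ F : Set (K → ℝ), (∀ f ∈ F, IsNASeminorm p k K f) ∧ t = seminormFamilyTop K F) ∧
    ∀ n : ℕ, @Continuous _ _ (KnTop k K Kn Knorm n) t Subtype.val}

/-- Locally constant functions with bounded (hence compact) support on Kₙ. -/
def IsTestFun (Knorm : K → ℝ) (n : ℕ) (φ : Kn n → ℂ) : Prop :=
  @IsLocallyConstant _ _ (KnTop k K Kn Knorm n) φ ∧
    ∃ R : ℝ, ∀ ξ : Kn n, R < Knorm ↑ξ → φ ξ = 0


/-- The fractional differentiation operator Dᵅ applied to the cylindrical function φ ∘ Tₙ. -/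
def Dop (Knorm : K → ℝ) (χ : k → ℂ) (pairing : K → ProjLim k K Kn T → k)
    (vol : ∀ n : ℕ, @MeasureTheory.Measure (Kn n) (KnMeas k K Kn Knorm n))
    (μ : @MeasureTheory.Measure (ProjLim k K Kn T) (projMeas k K Kn T Knorm))
    (α : ℝ) (n : ℕ) (φ : Kn n → ℂ) (x : ProjLim k K Kn T) : ℂ :=
  ∫ ξ : Kn n,
    χ ((finrank k (Kn n) : k)⁻¹ *
        Algebra.trace k (Kn n) (-(⟨x.1 n, x.2.1 n⟩ * ξ))) *
      (if 1 < Knorm ↑ξ then ((Knorm ↑ξ ^ α : ℝ) : ℂ) else 0) *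
      (∫ y, χ (pairing (↑ξ) y) * φ ⟨y.1 n, y.2.1 n⟩ ∂μ) ∂(vol n)
end

theorem absk_mul (p : ℕ) [Fact (Nat.Prime p)] (k : Type) [Field k] [Algebra ℚ_[p] k] (x y : k) :
    absk p k (x * y) = absk p k x * absk p k y := by
  simp [absk]

theorem absk_pow (p : ℕ) [Fact (Nat.Prime p)] (k : Type) [Field k] [Algebra ℚ_[p] k] (x : k)
    (n : ℕ) : absk p k (x ^ n) = absk p k x ^ n := by
  simp [absk]

theorem absk_nonneg (p : ℕ) [Fact (Nat.Prime p)] (k : Type) [Field k] [Algebra ℚ_[p] k] (x : k) :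
    0 ≤ absk p k x :=
  norm_nonneg _

theorem absk_one (p : ℕ) [Fact (Nat.Prime p)] (k : Type) [Field k] [Algebra ℚ_[p] k] :
    absk p k 1 = 1 := by
  simp [absk]

theorem absk_inv (p : ℕ) [Fact (Nat.Prime p)] (k : Type) [Field k] [Algebra ℚ_[p] k]
    {x : k} (hx : x ≠ 0) : absk p k x⁻¹ = (absk p k x)⁻¹ := by
  apply eq_inv_of_mul_eq_one_left
  rw [← absk_mul, inv_mul_cancel₀ hx, absk_one]

theorem absk_pos (p : ℕ) [Fact (Nat.Prime p)] (k : Type) [Field k] [Algebra ℚ_[p] k]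
    {x : k} (hx : x ≠ 0) : 0 < absk p k x := by
  refine (absk_nonneg p k x).lt_of_ne fun h => ?_
  have h1 := absk_mul p k x x⁻¹
  rw [mul_inv_cancel₀ hx, absk_one, ← h] at h1
  simp at h1

/-- A unimodular function whose mean with respect to a probability measure is `1` is almost
everywhere equal to `1`. -/
theorem ae_eq_one_of_integral_eq_one {X : Type*} [MeasurableSpace X] (μ : Measure X)
    [IsProbabilityMeasure μ] (f : X → ℂ) (hf : ∀ x, ‖f x‖ = 1) (hint : ∫ x, f x ∂μ = 1) :
    ∀ᵐ x ∂μ, f x = 1 := by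
  have hi : Integrable f μ := by
    by_contra h
    rw [integral_undef h] at hint
    exact zero_ne_one hint
  have hre : ∫ x, (f x).re ∂μ = 1 := by
    have h := integral_re hi
    rw [hint] at h
    simpa using h
  have hire : Integrable (fun x => (f x).re) μ := hi.re
  have hzero : ∫ x, (1 - (f x).re) ∂μ = 0 := by
    rw [integral_sub (integrable_const _) hire, hre]
    simp
  have hle : ∀ x, (f x).re ≤ 1 := fun x => hf x ▸ Complex.re_le_norm (f x)
  rw [integral_eq_zero_iff_of_nonneg (fun x => sub_nonneg.2 (hle x))
    ((integrable_const _).sub hire)] at hzero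
  filter_upwards [hzero] with x hx
  have h1 : (f x).re = 1 := by
    have h : 1 - (f x).re = 0 := hx
    linarith
  have h2 : (f x).re * (f x).re + (f x).im * (f x).im = 1 := by
    rw [← Complex.normSq_apply, Complex.normSq_eq_norm_sq, hf x, one_pow]
  rw [h1] at h2
  have h3 : (f x).im = 0 := by
    have h : (f x).im * (f x).im = 0 := by linarith
    simpa using h
  exact Complex.ext h1 h3

theorem statement_11
    (p : ℕ) [Fact (Nat.Prime p)]
    (k : Type) [Field k] [Algebra ℚ_[p] k] [FiniteDimensional ℚ_[p] k]
    (K : Type) [Field K] [Algebra k K] [CharZero K]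
    (Kn : ℕ → IntermediateField k K)
    (hbot : Kn 1 = ⊥) (hmono : Monotone Kn)
    [hfd : ∀ n, FiniteDimensional k (Kn n)]
    (hunion : ∀ x : K, ∃ n, x ∈ Kn n)
    (T : ℕ → K →ₗ[k] K)
    (hTmem : ∀ (n : ℕ) (x : K), T n x ∈ Kn n)
    (hTdef : ∀ (n ν : ℕ) (h : n ≤ ν) (x : K) (hx : x ∈ Kn ν),
      T n x = ((finrank k (Kn n) : K) / (finrank k (Kn ν) : K)) *
        (relTrace k K (Kn n) (Kn ν) (hmono h) ⟨x, hx⟩ : K))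
    (Knorm : K → ℝ)
    (hKnorm : ∀ (n : ℕ) (x : K) (hx : x ∈ Kn n),
      Knorm x = absk p k (Algebra.norm k (⟨x, hx⟩ : Kn n)) ^ ((finrank k (Kn n) : ℝ)⁻¹))
    (pairing : K → ProjLim k K Kn T → k)
    (hpair : ∀ (n : ℕ) (a : K) (ha : a ∈ Kn n) (x : ProjLim k K Kn T),
      pairing a x = (finrank k (Kn n) : k)⁻¹ *
        Algebra.trace k (Kn n) (⟨a * x.1 n, mul_mem ha (x.2.1 n)⟩ : Kn n))
    (q : ℕ → ℕ)
    (hq : ∀ n : ℕ, IsGreatest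
      {r : ℝ | (∃ x : Kn n, Knorm ↑x ^ (finrank k (Kn n) : ℝ) = r) ∧ r < 1} ((q n : ℝ)⁻¹))
    (χ : k → ℂ)
    (hχadd : ∀ x y : k, χ (x + y) = χ x * χ y)
    (hχnorm : ∀ x : k, ‖χ x‖ = 1)
    (hχcont : @Continuous _ _ (kTop p k) _ χ)
    (hχtriv : ∀ x : k, absk p k x ≤ 1 → χ x = 1)
    (hχrank : ∃ x : k, absk p k x ≤ (q 1 : ℝ) ∧ χ x ≠ 1)
    (d : ℕ → ℕ)
    (hd : ∀ (n : ℕ) (x : Kn n),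
      Knorm ↑x ^ (finrank k (Kn n) : ℝ) ≤ (q n : ℝ) ^ (d n : ℝ) ↔
        ∀ y : Kn n, Knorm ↑y ≤ 1 → absk p k (Algebra.trace k (Kn n) (x * y)) ≤ 1)
    (μ : @MeasureTheory.Measure (ProjLim k K Kn T) (projMeas k K Kn T Knorm))
    (hμprob : MeasureTheory.IsProbabilityMeasure μ)
    (hμradon : ∀ A : Set (ProjLim k K Kn T), MeasurableSet[projMeas k K Kn T Knorm] A →
      μ A = ⨆ (C : Set (ProjLim k K Kn T))
        (_ : C ⊆ A ∧ @IsCompact _ (projTop k K Kn T Knorm) C), μ C)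
    (hμchar : ∀ a : K, ∫ x, χ (pairing a x) ∂μ = if Knorm a ≤ 1 then (1 : ℂ) else 0)
    :
    ∀ y : ProjLim k K Kn T, y ∉ {x : ProjLim k K Kn T | ∀ n : ℕ, 1 ≤ n → Knorm (x.1 n) ≤ (q n : ℝ) ^ ((d n : ℝ) / (finrank k (Kn n) : ℝ)) * absk p k (finrank k (Kn n) : k)} →
      ∃ A : Set (ProjLim k K Kn T), MeasurableSet[projMeas k K Kn T Knorm] A ∧
        μ {x : ProjLim k K Kn T | pladd k K Kn T x y ∈ A} = 0 ∧ μ Aᶜ = 0 := by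
  intro y hy
  simp only [Set.mem_ofPred_eq, not_forall, not_le] at hy
  obtain ⟨n, -, hn⟩ := hy
  have : CharZero k := charZero_of_injective_algebraMap (algebraMap ℚ_[p] k).injective
  set N := finrank k (Kn n) with hN
  have hN0 : N ≠ 0 := finrank_pos.ne'
  have hNk : (N : k) ≠ 0 := Nat.cast_ne_zero.2 hN0
  have hpow : ∀ x : Kn n, Knorm x ^ (N : ℝ) = absk p k (Algebra.norm k x) := fun x => by
    rw [hKnorm n x x.2, Real.rpow_inv_rpow (absk_nonneg p k _) (Nat.cast_ne_zero.2 hN0)]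
  have hKnonneg : ∀ x : Kn n, 0 ≤ Knorm x := fun x => by
    rw [hKnorm n x x.2]
    exact Real.rpow_nonneg (absk_nonneg p k _) _
  have hle_one : ∀ x : Kn n, Knorm x ≤ 1 ↔ absk p k (Algebra.norm k x) ≤ 1 := fun x => by
    rw [← hpow, Real.rpow_natCast, pow_le_one_iff_of_nonneg (hKnonneg x) hN0]
  have hsmul : ∀ (c : k) (x : Kn n), absk p k (Algebra.norm k (c • x)) =
      absk p k c ^ N * absk p k (Algebra.norm k x) := fun c x => by
    rw [Algebra.smul_def, map_mul, Algebra.norm_algebraMap, absk_mul, absk_pow]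
  set Y : Kn n := ⟨y.1 n, y.2.1 n⟩ with hY
  have hlarge : ¬ Knorm ((N : k)⁻¹ • Y : Kn n) ^ (N : ℝ) ≤ (q n : ℝ) ^ (d n : ℝ) := by
    rw [not_le, hpow, hsmul, absk_inv p k hNk, inv_pow, ← div_eq_inv_mul,
      lt_div_iff₀ (pow_pos (absk_pos p k hNk) N), ← hpow Y]
    have h := Real.rpow_lt_rpow (mul_nonneg (by positivity) (absk_nonneg p k _)) hn
      (Nat.cast_pos.2 (Nat.pos_of_ne_zero hN0) : (0 : ℝ) < N)
    rwa [Real.mul_rpow (by positivity) (absk_nonneg p k _), ← Real.rpow_mul (by positivity),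
      div_mul_cancel₀ _ (Nat.cast_ne_zero.2 hN0), Real.rpow_natCast (absk p k _)] at h
  rw [hd] at hlarge
  push Not at hlarge
  obtain ⟨z, hz, ht⟩ := hlarge
  set t := Algebra.trace k (Kn n) ((N : k)⁻¹ • Y * z) with htdef
  have ht0 : t ≠ 0 := by
    intro h
    rw [h] at ht
    have : absk p k (0 : k) ≤ 1 := by
      have h2 := absk_mul p k 0 0
      rw [mul_zero] at h2
      nlinarith [absk_nonneg p k 0]
    linarith
  have htq : absk p k t⁻¹ ≤ (q 1 : ℝ)⁻¹ := by
    refine (hq 1).2 ⟨⟨algebraMap k (Kn 1) t⁻¹, ?_⟩, ?_⟩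
    · have hfin : finrank k (Kn 1) = 1 := by
        rw [hbot]
        exact IntermediateField.finrank_bot
      rw [hKnorm 1 _ (algebraMap k (Kn 1) t⁻¹).2, Subtype.coe_eta, Algebra.norm_algebraMap, hfin]
      simp
    · rw [absk_inv p k ht0]
      exact inv_lt_one_of_one_lt₀ ht
  obtain ⟨w, hw, hχw⟩ := hχrank
  set a : Kn n := (w * t⁻¹) • z with ha
  have ha_norm : Knorm a ≤ 1 := by
    rw [hle_one, ha, hsmul]
    refine mul_le_one₀ (pow_le_one₀ (absk_nonneg p k _) ?_) (absk_nonneg p k _) ((hle_one z).1 hz)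
    rw [absk_mul]
    exact (mul_le_mul hw htq (absk_nonneg p k _) (Nat.cast_nonneg _)).trans mul_inv_le_one
  have hay : pairing a y = w := by
    have h : (⟨(a : K) * y.1 n, mul_mem a.2 (y.2.1 n)⟩ : Kn n) = (w * t⁻¹) • (Y * z) := by
      rw [mul_comm Y z, ← smul_mul_assoc]
      rfl
    rw [hpair n a a.2, h, map_smul, smul_eq_mul]
    rw [smul_mul_assoc, map_smul, smul_eq_mul] at htdef
    calc (N : k)⁻¹ * (w * t⁻¹ * Algebra.trace k (Kn n) (Y * z))
        = w * t⁻¹ * ((N : k)⁻¹ * Algebra.trace k (Kn n) (Y * z)) := by ring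
      _ = w * t⁻¹ * t := by rw [← htdef]
      _ = w := inv_mul_cancel_right₀ ht0 w
  have hadd : ∀ x, pairing a (pladd k K Kn T x y) = pairing a x + pairing a y := fun x => by
    rw [hpair n a a.2, hpair n a a.2, hpair n a a.2, ← mul_add, ← map_add]
    congr 2
    exact Subtype.ext (mul_add _ _ _)
  let _ : MeasurableSpace (ProjLim k K Kn T) := projMeas k K Kn T Knorm
  have hae : ∀ᵐ x ∂μ, χ (pairing a x) = 1 :=
    ae_eq_one_of_integral_eq_one μ _ (fun x => hχnorm _) (by rw [hμchar, if_pos ha_norm])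
  set B : Set (ProjLim k K Kn T) := {x | ¬ χ (pairing a x) = 1} with hB
  have hB0 : μ B = 0 := hae
  refine ⟨(toMeasurable μ B)ᶜ, (measurableSet_toMeasurable μ B).compl, ?_, ?_⟩
  · refine measure_mono_null (t := B) (fun x hx => Set.mem_ofPred_eq ▸ fun hx1 => ?_) hB0
    have hxy : χ (pairing a (pladd k K Kn T x y)) = 1 := by
      by_contra h
      exact hx (subset_toMeasurable μ B h)
    rw [hadd, hχadd, hx1, one_mul, hay] at hxy
    exact hχw hxy
  · rw [compl_compl, measure_toMeasurable, hB0]
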